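/- Let X be a multiset of n points in ℤ^d, k a positive integer dividing n, and S_1,...,S_t pairwise disjoint submultisets of X, each consisting of n/k identical points. Let Y = X minus (S_1 ∪ ... ∪ S_t). Then the minimum cost of an equal (k−t)-clustering of Y is at most twice the minimum cost of an equal k-clustering of X. -/

import Mathlib

open Finset

/-- The ℓ_p norm of a real vector, for integer `p ≥ 1`. -/
noncomputable def lpNorm (p : ℕ) {d : ℕ} (x : Fin d → ℝ) : ℝ :=
  (∑ i, |x i| ^ p) ^ ((1 : ℝ) / p)

/-- Cost of a cluster (multiset of integer points) with respect to a given center `c`. -/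
noncomputable def costW (p : ℕ) {d : ℕ} (T : Multiset (Fin d → ℤ)) (c : Fin d → ℝ) : ℝ :=
  (T.map (fun x => lpNorm p (fun i => c i - (x i : ℝ)))).sum

/-- Cost of a cluster: infimum over all centers `c ∈ ℝ^d`. -/
noncomputable def clCost (p : ℕ) {d : ℕ} (T : Multiset (Fin d → ℤ)) : ℝ :=
  sInf (Set.range (costW p T))

/-- Minimum cost of an equal clustering of `P` into `k` clusters of size `s` each. -/
noncomputable def OptCost (p : ℕ) {d : ℕ} (P : Multiset (Fin d → ℤ)) (k s : ℕ) : ℝ :=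
  sInf {r | ∃ X : Fin k → Multiset (Fin d → ℤ),
    (∑ i, X i = P) ∧ (∀ i, (X i).card = s) ∧ r = ∑ i, clCost p (X i)}

namespace EqClust

lemma redistribute {α ι : Type*} [DecidableEq α] [DecidableEq ι] (f : ι → α → ℝ)
    (hf : ∀ i a, 0 ≤ f i a) (tri : ∀ i j a b, f i b ≤ f i a + f j a + f j b)
    (I : Finset ι) (j : ι) (x : α) (m : ℕ) :
    ∀ (D : Multiset α) (X : ι → Multiset α), D.card = m →
      Multiset.replicate m x ≤ D + ∑ i ∈ I, X i →
      ∃ Z : ι → Multiset α, (∀ i, (Z i).card = (X i).card) ∧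
        Multiset.replicate m x + ∑ i ∈ I, Z i = D + ∑ i ∈ I, X i ∧
        ∑ i ∈ I, ((Z i).map (f i)).sum ≤
          ∑ i ∈ I, ((X i).map (f i)).sum + (D.map (f j)).sum + m * f j x := by
  induction m with
  | zero =>
    intro D X hD _
    rw [Multiset.card_eq_zero] at hD
    subst hD
    exact ⟨X, fun _ => rfl, by simp, by simp⟩
  | succ m ih =>
    intro D X hD hle
    by_cases hx : x ∈ D
    · obtain ⟨D', rfl⟩ := Multiset.exists_cons_of_mem hx
      rw [Multiset.card_cons] at hD
      rw [Multiset.replicate_succ, Multiset.cons_add, Multiset.cons_le_cons_iff] at hle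
      obtain ⟨Z, h1, h2, h3⟩ := ih D' X (by omega) hle
      refine ⟨Z, h1, ?_, ?_⟩
      · rw [Multiset.replicate_succ, Multiset.cons_add, Multiset.cons_add, h2]
      · have := hf j x
        simp only [Multiset.map_cons, Multiset.sum_cons]
        push_cast
        linarith
    · have hxm : x ∈ D + ∑ i ∈ I, X i :=
        Multiset.mem_of_le hle (by simp)
      have hxs : x ∈ ∑ i ∈ I, X i := by
        rcases Multiset.mem_add.1 hxm with h | h
        · exact absurd h hx
        · exact h
      obtain ⟨i, hi, hxi⟩ := Multiset.mem_sum.1 hxs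
      obtain ⟨W, hW⟩ := Multiset.exists_cons_of_mem hxi
      obtain ⟨y, hy⟩ : ∃ y, y ∈ D := Multiset.card_pos_iff_exists_mem.1 (by omega)
      obtain ⟨D', rfl⟩ := Multiset.exists_cons_of_mem hy
      rw [Multiset.card_cons] at hD
      have hsX : ∑ i ∈ I, X i = x ::ₘ (W + ∑ l ∈ I.erase i, X l) := by
        rw [← Finset.add_sum_erase I X hi, hW, Multiset.cons_add]
      have hsU : ∑ l ∈ I, Function.update X i (y ::ₘ W) l
          = y ::ₘ (W + ∑ l ∈ I.erase i, X l) := by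
        rw [← Finset.add_sum_erase I _ hi, Function.update_self, Multiset.cons_add]
        congr 2
        apply Finset.sum_congr rfl
        intro l hl
        rw [Function.update_of_ne (Finset.ne_of_mem_erase hl)]
      have key : y ::ₘ D' + ∑ i ∈ I, X i =
          x ::ₘ (D' + ∑ l ∈ I, Function.update X i (y ::ₘ W) l) := by
        rw [hsX, hsU]
        simp only [Multiset.cons_add, Multiset.add_cons, Multiset.cons_swap x y]
      rw [key, Multiset.replicate_succ, Multiset.cons_le_cons_iff] at hle
      obtain ⟨Z, h1, h2, h3⟩ := ih D' _ (by omega) hle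
      refine ⟨Z, ?_, ?_, ?_⟩
      · intro l
        rw [h1]
        by_cases hl : l = i
        · subst hl; simp [hW]
        · rw [Function.update_of_ne hl]
      · rw [key, Multiset.replicate_succ, Multiset.cons_add, h2]
      · have e1 : ∑ l ∈ I, ((X l).map (f l)).sum =
            f i x + (W.map (f i)).sum + ∑ l ∈ I.erase i, ((X l).map (f l)).sum := by
          rw [← Finset.add_sum_erase I _ hi, hW]; simp
        have e2 : ∑ l ∈ I, ((Function.update X i (y ::ₘ W) l).map (f l)).sum =
            f i y + (W.map (f i)).sum + ∑ l ∈ I.erase i, ((X l).map (f l)).sum := by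
          rw [← Finset.add_sum_erase I _ hi, Function.update_self]
          simp only [Multiset.map_cons, Multiset.sum_cons]
          congr 1
          apply Finset.sum_congr rfl
          intro l hl
          rw [Function.update_of_ne (Finset.ne_of_mem_erase hl)]
        have := tri i j x y
        simp only [Multiset.map_cons, Multiset.sum_cons]
        push_cast
        linarith

lemma removeAll {α ι τ : Type*} [DecidableEq α] [DecidableEq ι] [DecidableEq τ] (f : ι → α → ℝ)
    (hf : ∀ i a, 0 ≤ f i a) (tri : ∀ i j a b, f i b ≤ f i a + f j a + f j b)
    (x : τ → α) (σ : τ → ι) (hσ : Function.Injective σ) (s : ℕ) (H : Finset τ) :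
    ∀ (I : Finset ι) (X : ι → Multiset α), H.image σ ⊆ I → (∀ i ∈ I, (X i).card = s) →
      ∑ h ∈ H, Multiset.replicate s (x h) ≤ ∑ i ∈ I, X i →
      ∃ Z : ι → Multiset α, (∀ i ∈ I \ H.image σ, (Z i).card = s) ∧
        ∑ h ∈ H, Multiset.replicate s (x h) + ∑ i ∈ I \ H.image σ, Z i = ∑ i ∈ I, X i ∧
        ∑ i ∈ I \ H.image σ, ((Z i).map (f i)).sum ≤
          ∑ i ∈ I, ((X i).map (f i)).sum + s * ∑ h ∈ H, f (σ h) (x h) := by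
  induction H using Finset.induction_on with
  | empty =>
    intro I X _ hc _
    exact ⟨X, by simpa using hc, by simp, by simp⟩
  | insert h H hh ih =>
    intro I X hI hc hle
    have hjI : σ h ∈ I := hI (by simp)
    rw [Finset.sum_insert hh, ← Finset.add_sum_erase I X hjI] at hle
    obtain ⟨X', h1, h2, h3⟩ := redistribute f hf tri (I.erase (σ h)) (σ h) (x h) s (X (σ h)) X
      (hc _ hjI) ((Multiset.le_add_right _ _).trans hle)
    rw [← h2] at hle
    have hset : I \ (insert h H).image σ = I.erase (σ h) \ H.image σ := by
      ext i; simp only [Finset.image_insert, Finset.mem_sdiff, Finset.mem_insert,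
        Finset.mem_erase]; tauto
    obtain ⟨Z, g1, g2, g3⟩ := ih (I.erase (σ h)) X' (by
      intro i hi
      rw [Finset.mem_erase]
      refine ⟨?_, hI (by rw [Finset.image_insert]; exact Finset.mem_insert_of_mem hi)⟩
      rintro rfl
      obtain ⟨h', hh', he⟩ := Finset.mem_image.1 hi
      exact hh (hσ he ▸ hh'))
      (fun i hi => (h1 i).trans (hc i (Finset.mem_of_mem_erase hi)))
      ((add_le_add_iff_left _).1 hle)
    refine ⟨Z, ?_, ?_, ?_⟩
    · rw [hset]; exact g1
    · rw [hset, Finset.sum_insert hh, add_assoc, g2, h2, Finset.add_sum_erase I X hjI]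
    · rw [hset, Finset.sum_insert hh]
      have := Finset.add_sum_erase I (fun i => ((X i).map (f i)).sum) hjI
      rw [mul_add]
      linarith

lemma split_le {α ι : Type*} [DecidableEq α] [DecidableEq ι] (I : Finset ι) :
    ∀ (A : Multiset α) (X : ι → Multiset α), A ≤ ∑ i ∈ I, X i →
      ∃ B : ι → Multiset α, (∀ i ∈ I, B i ≤ X i) ∧ ∑ i ∈ I, B i = A := by
  induction I using Finset.induction_on with
  | empty =>
    intro A X h
    refine ⟨fun _ => 0, by simp, ?_⟩
    simp only [Finset.sum_empty] at h ⊢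
    exact (Multiset.le_zero.1 h).symm
  | insert i I hi ih =>
    intro A X h
    rw [Finset.sum_insert hi] at h
    obtain ⟨B, h1, h2⟩ := ih (A - X i) X (by rwa [tsub_le_iff_left])
    refine ⟨Function.update B i (A ∩ X i), ?_, ?_⟩
    · intro l hl
      by_cases hli : l = i
      · subst hli; simp [Multiset.inter_le_right]
      · rw [Function.update_of_ne hli]
        exact h1 l ((Finset.mem_insert.1 hl).resolve_left hli)
    · rw [Finset.sum_insert hi, Function.update_self]
      have : ∑ l ∈ I, Function.update B i (A ∩ X i) l = A - X i := by
        rw [← h2]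
        apply Finset.sum_congr rfl
        intro l hl
        rw [Function.update_of_ne]
        rintro rfl; exact hi hl
      rw [this]
      ext a
      simp only [Multiset.count_add, Multiset.count_inter, Multiset.count_sub]
      omega

lemma refine_le {α ι τ : Type*} [DecidableEq α] [DecidableEq ι] [DecidableEq τ] [Fintype ι]
    (B : τ → Multiset α) (H : Finset τ) :
    ∀ (X : ι → Multiset α), ∑ h ∈ H, B h ≤ ∑ i, X i →
      ∃ C : τ → ι → Multiset α, (∀ h ∈ H, ∑ i, C h i = B h) ∧ ∀ i, ∑ h ∈ H, C h i ≤ X i := by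
  induction H using Finset.induction_on with
  | empty =>
    intro X _
    exact ⟨fun _ _ => 0, by simp, by simp⟩
  | insert h H hh ih =>
    intro X hle
    rw [Finset.sum_insert hh] at hle
    obtain ⟨A, a1, a2⟩ := split_le Finset.univ (B h) X ((Multiset.le_add_right _ _).trans hle)
    have hX : ∑ i, X i = B h + ∑ i, (X i - A i) := by
      rw [← a2, ← Finset.sum_add_distrib]
      exact Finset.sum_congr rfl fun i hi => (add_tsub_cancel_of_le (a1 i hi)).symm
    rw [hX, add_le_add_iff_left] at hle
    obtain ⟨C, c1, c2⟩ := ih _ hle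
    have hne : ∀ l ∈ H, l ≠ h := by rintro l hl rfl; exact hh hl
    refine ⟨Function.update C h A, ?_, ?_⟩
    · intro l hl
      by_cases hlh : l = h
      · subst hlh; simpa using a2
      · rw [Function.update_of_ne hlh]
        exact c1 l ((Finset.mem_insert.1 hl).resolve_left hlh)
    · intro i
      rw [Finset.sum_insert hh, Function.update_self]
      have : ∑ l ∈ H, Function.update C h A l i = ∑ l ∈ H, C l i :=
        Finset.sum_congr rfl fun l hl => by rw [Function.update_of_ne (hne l hl)]
      rw [this]
      calc A i + ∑ l ∈ H, C l i ≤ A i + (X i - A i) := by gcongr; exact c2 i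
        _ = X i := add_tsub_cancel_of_le (a1 i (Finset.mem_univ i))

/-- A cheap injective assignment, from Birkhoff's theorem. -/
lemma exists_matching {t r : ℕ} (a w : Fin t → Fin (t + r) → ℝ) (s : ℝ) (hs : 0 < s)
    (ha : ∀ h i, 0 ≤ a h i) (hrow : ∀ h, ∑ i, a h i = s) (hcol : ∀ i, ∑ h, a h i ≤ s) :
    ∃ σ : Fin t → Fin (t + r), Function.Injective σ ∧
      s * ∑ h, w h (σ h) ≤ ∑ h, ∑ i, a h i * w h i := by
  classical
  let M : Matrix (Fin (t + r)) (Fin (t + r)) ℝ := fun u i =>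
    Fin.addCases (fun h => a h i / s) (fun _ => (1 - ∑ h, a h i / s) / r) u
  have hM1 : ∀ h i, M (Fin.castAdd r h) i = a h i / s := fun h i => by simp [M]
  have hM2 : ∀ q i, M (Fin.natAdd t q) i = (1 - ∑ h, a h i / s) / r := fun q i => by simp [M]
  have hcol' : ∀ i, ∑ h, a h i / s ≤ 1 := fun i => by
    rw [← Finset.sum_div, div_le_one hs]; exact hcol i
  have htot : ∑ i, ∑ h, a h i / s = t := by
    rw [Finset.sum_comm]
    simp_rw [← Finset.sum_div, hrow]
    simp [hs.ne']
  have htot' : ∑ i, (1 - ∑ h, a h i / s) = r := by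
    rw [Finset.sum_sub_distrib, htot]; simp
  have hM : M ∈ doublyStochastic ℝ (Fin (t + r)) := by
    rw [mem_doublyStochastic_iff_sum]
    refine ⟨?_, ?_, ?_⟩
    · intro u i
      refine Fin.addCases (fun h => ?_) (fun q => ?_) u
      · rw [hM1]; exact div_nonneg (ha h i) hs.le
      · rw [hM2]; exact div_nonneg (sub_nonneg.2 (hcol' i)) (Nat.cast_nonneg _)
    · intro u
      refine Fin.addCases (fun h => ?_) (fun q => ?_) u
      · simp_rw [hM1, ← Finset.sum_div, hrow]; exact div_self hs.ne'
      · simp_rw [hM2]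
        rw [← Finset.sum_div, htot']
        have : 0 < r := q.pos
        field_simp
    · intro i
      rw [Fin.sum_univ_add]
      simp_rw [hM1, hM2]
      rcases Nat.eq_zero_or_pos r with hr | hr
      · have h0 : ∀ i ∈ Finset.univ, (0:ℝ) ≤ 1 - ∑ h, a h i / s :=
          fun i _ => sub_nonneg.2 (hcol' i)
        have htot' := htot'.trans (show (r : ℝ) = 0 by rw [hr, Nat.cast_zero])
        have := (Finset.sum_eq_zero_iff_of_nonneg h0).1 htot' i (Finset.mem_univ i)
        rw [this]
        simp
        linarith
      · simp only [Finset.sum_const, Finset.card_univ, Fintype.card_fin, nsmul_eq_mul]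
        field_simp
        ring
  obtain ⟨v, v0, v1, vM⟩ := exists_eq_sum_perm_of_mem_doublyStochastic hM
  let F : Equiv.Perm (Fin (t + r)) → ℝ := fun π => ∑ h, w h (π (Fin.castAdd r h))
  have hF : ∑ π, v π * F π = ∑ h, ∑ i, a h i / s * w h i := by
    simp_rw [← hM1, ← vM, Matrix.sum_apply, Finset.sum_mul, F, Finset.mul_sum]
    rw [Finset.sum_comm]
    refine Finset.sum_congr rfl fun h _ => ?_
    rw [Finset.sum_comm]
    refine Finset.sum_congr rfl fun π _ => ?_
    rw [Finset.sum_eq_single (π (Fin.castAdd r h))]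
    · simp [Equiv.Perm.permMatrix, PEquiv.toMatrix_apply]
    · intro b _ hb
      simp [Equiv.Perm.permMatrix, PEquiv.toMatrix_apply, hb.symm]
    · simp
  obtain ⟨π, hπ⟩ : ∃ π, F π ≤ ∑ π, v π * F π := by
    by_contra! hcon
    obtain ⟨π0, _, hmin⟩ := Finset.exists_min_image Finset.univ F ⟨1, Finset.mem_univ _⟩
    have : F π0 ≤ ∑ π, v π * F π := by
      calc F π0 = ∑ π, v π * F π0 := by rw [← Finset.sum_mul, v1, one_mul]
        _ ≤ _ := Finset.sum_le_sum fun π hπ =>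
          mul_le_mul_of_nonneg_left (hmin π hπ) (v0 π)
    exact absurd this (not_le.2 (hcon π0))
  refine ⟨fun h => π (Fin.castAdd r h), fun h h' e => ?_, ?_⟩
  · simpa using e
  · rw [hF] at hπ
    have := mul_le_mul_of_nonneg_left hπ hs.le
    refine this.trans (le_of_eq ?_)
    simp_rw [Finset.mul_sum]
    refine Finset.sum_congr rfl fun h _ => Finset.sum_congr rfl fun i _ => ?_
    field_simp

lemma exists_matching' {t r : ℕ} (s : ℕ) {α : Type*} [DecidableEq α]
    (f : Fin (t + r) → α → ℝ) (hf : ∀ i a, 0 ≤ f i a)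
    (X : Fin (t + r) → Multiset α) (hX : ∀ i, (X i).card = s) (x : Fin t → α)
    (hle : ∑ h, Multiset.replicate s (x h) ≤ ∑ i, X i) :
    ∃ σ : Fin t → Fin (t + r), Function.Injective σ ∧
      s * ∑ h, f (σ h) (x h) ≤ ∑ i, ((X i).map (f i)).sum := by
  rcases Nat.eq_zero_or_pos s with rfl | hs
  · refine ⟨Fin.castAdd r, Fin.castAdd_injective t r, ?_⟩
    have : ∀ i, X i = 0 := fun i => Multiset.card_eq_zero.1 (hX i)
    simp [this]
  obtain ⟨C, c1, c2⟩ := refine_le (fun h => Multiset.replicate s (x h)) Finset.univ X hle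
  have hCrep : ∀ h i, C h i = Multiset.replicate (C h i).card (x h) := by
    intro h i
    rw [Multiset.eq_replicate_card]
    intro b hb
    have : b ∈ ∑ i, C h i := Multiset.mem_sum.2 ⟨i, Finset.mem_univ i, hb⟩
    rw [c1 h (Finset.mem_univ h)] at this
    exact Multiset.eq_of_mem_replicate this
  obtain ⟨σ, h1, h2⟩ := exists_matching (fun h i => ((C h i).card : ℝ)) (fun h i => f i (x h)) s
    (by exact_mod_cast hs) (fun _ _ => Nat.cast_nonneg _)
    (fun h => by
      have := congrArg Multiset.card (c1 h (Finset.mem_univ h))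
      rw [Multiset.card_sum, Multiset.card_replicate] at this
      exact_mod_cast this)
    (fun i => by
      have := Multiset.card_le_card (c2 i)
      rw [Multiset.card_sum, hX] at this
      exact_mod_cast this)
  refine ⟨σ, h1, h2.trans ?_⟩
  rw [Finset.sum_comm]
  refine Finset.sum_le_sum fun i _ => ?_
  have e : ∑ h, ((C h i).card : ℝ) * f i (x h) = ((∑ h, C h i).map (f i)).sum := by
    have h3 := map_sum ((Multiset.sumAddMonoidHom (M := ℝ)).comp (Multiset.mapAddMonoidHom (f i)))
      (fun h => C h i) Finset.univ
    simp only [AddMonoidHom.comp_apply, Multiset.coe_mapAddMonoidHom,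
      Multiset.coe_sumAddMonoidHom] at h3
    rw [h3]
    refine Finset.sum_congr rfl fun h _ => ?_
    conv_rhs => rw [hCrep h i]
    simp
  rw [e]
  obtain ⟨R, hR⟩ := Multiset.le_iff_exists_add.1 (c2 i)
  rw [hR, Multiset.map_add, Multiset.sum_add]
  have : 0 ≤ (R.map (f i)).sum := Multiset.sum_nonneg (by
    intro b hb
    obtain ⟨z, _, rfl⟩ := Multiset.mem_map.1 hb
    exact hf i z)
  linarith

lemma main_abs {t r s : ℕ} {α : Type*} [DecidableEq α]
    (f : Fin (t + r) → α → ℝ) (hf : ∀ i a, 0 ≤ f i a)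
    (tri : ∀ i j a b, f i b ≤ f i a + f j a + f j b)
    (X : Fin (t + r) → Multiset α) (hX : ∀ i, (X i).card = s) (x : Fin t → α)
    (hle : ∑ h, Multiset.replicate s (x h) ≤ ∑ i, X i) :
    ∃ (Z : Fin r → Multiset α) (e : Fin r → Fin (t + r)),
      ∑ i, Z i = ∑ i, X i - ∑ h, Multiset.replicate s (x h) ∧ (∀ i, (Z i).card = s) ∧
      ∑ i, ((Z i).map (f (e i))).sum ≤ 2 * ∑ i, ((X i).map (f i)).sum := by
  obtain ⟨σ, hσ, hc⟩ := exists_matching' s f hf X hX x hle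
  obtain ⟨Z, z1, z2, z3⟩ := removeAll f hf tri x σ hσ s Finset.univ Finset.univ X
    (Finset.subset_univ _) (fun i _ => hX i) hle
  set J := Finset.univ \ Finset.univ.image σ with hJ
  have hcard : J.card = r := by
    rw [hJ, Finset.card_sdiff_of_subset (Finset.subset_univ _), Finset.card_image_of_injective _ hσ]
    simp
  let E : Fin r ≃ J := (J.equivFinOfCardEq hcard).symm
  have hsum : ∀ {M : Type _} [AddCommMonoid M] (g : Fin (t + r) → M),
      ∑ i, g (E i) = ∑ i ∈ J, g i := by
    intro M _ g
    rw [← Finset.sum_coe_sort J g]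
    exact E.sum_comp (fun j => g j)
  refine ⟨fun i => Z (E i), fun i => E i, ?_, fun i => z1 _ (E i).2, ?_⟩
  · rw [hsum Z, ← z2, add_tsub_cancel_left]
  · have e1 : ∑ i, ((Z (E i)).map (f (E i))).sum = ∑ i ∈ J, ((Z i).map (f i)).sum := by
      rw [← Finset.sum_coe_sort J]
      exact E.sum_comp (fun j => ((Z j).map (f j)).sum)
    rw [e1]
    linarith

lemma exists_clustering {α : Type*} [DecidableEq α] (s k : ℕ) :
    ∀ P : Multiset α, P.card = s * k →
      ∃ X : Fin k → Multiset α, ∑ i, X i = P ∧ ∀ i, (X i).card = s := by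
  induction k with
  | zero =>
    intro P hP
    refine ⟨fun _ => 0, ?_, fun i => i.elim0⟩
    have := Multiset.card_eq_zero.1 (hP.trans (mul_zero s))
    simp [this]
  | succ k ih =>
    intro P hP
    obtain ⟨l, rfl⟩ : ∃ l : List α, (l : Multiset α) = P := Quot.exists_rep P
    rw [Multiset.coe_card, mul_add, mul_one] at hP
    obtain ⟨X, h1, h2⟩ := ih (l.drop s : Multiset α) (by simp [hP])
    refine ⟨Fin.cons (l.take s : Multiset α) X, ?_, ?_⟩
    · rw [Fin.sum_univ_succ]
      simp only [Fin.cons_zero, Fin.cons_succ, h1, Multiset.coe_add, List.take_append_drop]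
    · intro i
      refine Fin.cases ?_ (fun i => ?_) i
      · simp [hP]
      · simpa using h2 i

lemma lpNorm_nonneg (p : ℕ) {d : ℕ} (x : Fin d → ℝ) : 0 ≤ lpNorm p x := by
  unfold lpNorm; positivity

lemma lpNorm_add_le (p : ℕ) (hp : 1 ≤ p) {d : ℕ} (x y : Fin d → ℝ) :
    lpNorm p (fun i => x i + y i) ≤ lpNorm p x + lpNorm p y := by
  have := Real.Lp_add_le Finset.univ x y (p := p) (by exact_mod_cast hp)
  simpa only [lpNorm, Real.rpow_natCast] using this

lemma lpNorm_neg (p : ℕ) {d : ℕ} (x : Fin d → ℝ) :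
    lpNorm p (fun i => - x i) = lpNorm p x := by
  simp [lpNorm]

lemma costW_nonneg (p : ℕ) {d : ℕ} (T : Multiset (Fin d → ℤ)) (c : Fin d → ℝ) :
    0 ≤ costW p T c := Multiset.sum_nonneg (by
  intro b hb
  obtain ⟨z, _, rfl⟩ := Multiset.mem_map.1 hb
  exact lpNorm_nonneg _ _)

lemma clCost_le (p : ℕ) {d : ℕ} (T : Multiset (Fin d → ℤ)) (c : Fin d → ℝ) :
    clCost p T ≤ costW p T c :=
  csInf_le ⟨0, by rintro _ ⟨c, rfl⟩; exact costW_nonneg p T c⟩ ⟨c, rfl⟩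

lemma clCost_nonneg (p : ℕ) {d : ℕ} (T : Multiset (Fin d → ℤ)) : 0 ≤ clCost p T :=
  Real.sInf_nonneg (by rintro _ ⟨c, rfl⟩; exact costW_nonneg p T c)

lemma optCost_le (p : ℕ) {d k s : ℕ} (X : Fin k → Multiset (Fin d → ℤ))
    (hX : ∀ i, (X i).card = s) : OptCost p (∑ i, X i) k s ≤ ∑ i, clCost p (X i) :=
  csInf_le ⟨0, by
    rintro _ ⟨X, _, _, rfl⟩
    exact Finset.sum_nonneg fun i _ => clCost_nonneg p _⟩ ⟨X, rfl, hX, rfl⟩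

lemma tri (p : ℕ) (hp : 1 ≤ p) {d : ℕ} (c c' : Fin d → ℝ) (a b : Fin d → ℤ) :
    lpNorm p (fun i => c i - (b i : ℝ)) ≤ lpNorm p (fun i => c i - (a i : ℝ)) +
      lpNorm p (fun i => c' i - (a i : ℝ)) + lpNorm p (fun i => c' i - (b i : ℝ)) := by
  have h1 := lpNorm_add_le p hp (fun i => c i - (a i : ℝ)) (fun i => (a i : ℝ) - b i)
  have h2 := lpNorm_add_le p hp (fun i => -(c' i - (a i : ℝ))) (fun i => c' i - (b i : ℝ))
  rw [lpNorm_neg] at h2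
  have e1 : (fun i => c i - (a i : ℝ) + ((a i : ℝ) - b i)) = fun i => c i - (b i : ℝ) := by
    ext i; ring
  have e2 : (fun i => -(c' i - (a i : ℝ)) + (c' i - (b i : ℝ))) = fun i => (a i : ℝ) - b i := by
    ext i; ring
  rw [e1] at h1
  rw [e2] at h2
  linarith

end EqClust

/-- removing `t` disjoint groups of `s = n/k` identical points each from `P`
at most doubles the optimum equal-clustering cost (now with `k - t` clusters). -/
theorem opt_after_removing_identical_groups_le_twice_opt
    {d k t s : ℕ} (p : ℕ) (hp : 1 ≤ p) (ht : t ≤ k)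
    (P : Multiset (Fin d → ℤ)) (hP : P.card = s * k)
    (x : Fin t → Fin d → ℤ)
    (hsub : (∑ h, Multiset.replicate s (x h)) ≤ P) :
    OptCost p (P - ∑ h, Multiset.replicate s (x h)) (k - t) s ≤
      2 * OptCost p P k s := by
  obtain ⟨r, rfl⟩ := Nat.exists_eq_add_of_le ht
  rw [Nat.add_sub_cancel_left]
  have h2 : OptCost p (P - ∑ h, Multiset.replicate s (x h)) r s / 2 ≤ OptCost p P (t + r) s := by
    apply le_csInf
    · obtain ⟨X, h1, h2⟩ := EqClust.exists_clustering s (t + r) P hP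
      exact ⟨_, X, h1, h2, rfl⟩
    · rintro _ ⟨X, rfl, hX, rfl⟩
      apply le_of_forall_pos_le_add
      intro ε hε
      have hδ : 0 < ε / ((t + r : ℕ) + 1 : ℝ) := by positivity
      have hc : ∀ i, ∃ c, costW p (X i) c < clCost p (X i) + ε / ((t + r : ℕ) + 1 : ℝ) := by
        intro i
        obtain ⟨_, ⟨c, rfl⟩, h⟩ := Real.lt_sInf_add_pos (Set.range_nonempty (costW p (X i))) hδ
        exact ⟨c, h⟩
      choose c hc using hc
      obtain ⟨Z, e, z1, z2, z3⟩ := EqClust.main_abs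
        (fun i (a : Fin d → ℤ) => lpNorm p (fun l => c i l - (a l : ℝ)))
        (fun _ _ => EqClust.lpNorm_nonneg _ _)
        (fun i j a b => EqClust.tri p hp (c i) (c j) a b) X hX x hsub
      rw [← z1]
      have k1 := EqClust.optCost_le p Z z2
      have k2 : ∑ i, clCost p (Z i) ≤ ∑ i, costW p (Z i) (c (e i)) :=
        Finset.sum_le_sum fun i _ => EqClust.clCost_le p _ _
      have k3 : ∑ i, costW p (X i) (c i) ≤
          ∑ i, (clCost p (X i) + ε / ((t + r : ℕ) + 1 : ℝ)) :=
        Finset.sum_le_sum fun i _ => (hc i).le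
      have k4 : ((t + r : ℕ) : ℝ) * (ε / ((t + r : ℕ) + 1 : ℝ)) ≤ ε := by
        rw [← mul_div_assoc, div_le_iff₀ (by positivity)]
        nlinarith
      rw [Finset.sum_add_distrib, Finset.sum_const, Finset.card_univ, Fintype.card_fin,
        nsmul_eq_mul] at k3
      change ∑ i, costW p (Z i) (c (e i)) ≤ 2 * ∑ i, costW p (X i) (c i) at z3
      linarith
  linarith
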